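/- Let k > 0 and M ≥ 0. Let Θ : ℝ × ℝ² → ℝ be twice continuously differentiable in all variables with Θ(t,·) supported in a fixed compact set for all t, let U : ℝ × ℝ² → ℝ² be continuous with div_x U(t,·) = 0 and sup_x |U(t,x)| ≤ M for all t, and let Υ : ℝ × ℝ² → ℝ be continuous with Υ(t,·) square-integrable. Suppose ∂ₜΘ − k·ΔΘ + U·∇Θ = Υ pointwise. Then the function F(t) = ∫_{ℝ²} |∇Θ(t,x)|² dx is differentiable and satisfies, for every t, (1/2)∫_{ℝ²} (∂ₜΘ(t,x))² dx + (k/2)·F'(t) ≤ ∫_{ℝ²} Υ(t,x)² dx + M² · F(t). -/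

import Mathlib

open MeasureTheory RealInnerProductSpace

noncomputable abbrev E2 : Type := EuclideanSpace ℝ (Fin 2)

/-- Time derivative of a (time × space)-dependent scalar field. -/
noncomputable def dts (Θ : ℝ × E2 → ℝ) (t : ℝ) (x : E2) : ℝ :=
  deriv (fun s => Θ (s, x)) t

/-- Spatial gradient of a (time × space)-dependent scalar field. -/
noncomputable def sgrad (Θ : ℝ × E2 → ℝ) (t : ℝ) (x : E2) : E2 :=
  gradient (fun y => Θ (t, y)) x

/-- Spatial Laplacian of a (time × space)-dependent scalar field. -/
noncomputable def slapS (Θ : ℝ × E2 → ℝ) (t : ℝ) (x : E2) : ℝ :=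
  ∑ i : Fin 2,
    fderiv ℝ (fderiv ℝ fun y => Θ (t, y)) x (EuclideanSpace.single i 1)
      (EuclideanSpace.single i 1)

lemma fd_zero_off {F : Type*} [NormedAddCommGroup F] [NormedSpace ℝ F] {K : Set E2}
    (hK : IsCompact K) {G : ℝ × E2 → F} (hG : ∀ t x, x ∉ K → G (t, x) = 0) (t : ℝ) (x : E2)
    (hx : x ∉ K) : fderiv ℝ G (t, x) = 0 := by
  have hopen : IsOpen {p : ℝ × E2 | p.2 ∉ K} :=
    (hK.isClosed.isOpen_compl).preimage continuous_snd
  have : G =ᶠ[nhds (t, x)] fun _ => 0 := by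
    filter_upwards [hopen.mem_nhds (show (t, x) ∈ {p : ℝ × E2 | p.2 ∉ K} from hx)] with p hp
    exact hG p.1 p.2 hp
  rw [this.fderiv_eq]
  simp

lemma slice_integrable {K : Set E2} (hK : IsCompact K) {G : ℝ × E2 → ℝ} (hc : Continuous G)
    (hG : ∀ t x, x ∉ K → G (t, x) = 0) (t : ℝ) : Integrable (fun x => G (t, x)) := by
  apply Continuous.integrable_of_hasCompactSupport (by fun_prop)
  exact HasCompactSupport.intro hK (fun x hx => hG t x hx)

lemma hasDeriv_slice_t {G : ℝ × E2 → ℝ} (hc : Differentiable ℝ G) (t : ℝ) (x : E2) :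
    HasDerivAt (fun s => G (s, x)) (fderiv ℝ G (t, x) (1, 0)) t := by
  have h1 : HasDerivAt (fun s : ℝ => (s, x)) ((1 : ℝ), (0 : E2)) t :=
    (hasDerivAt_id t).prodMk (hasDerivAt_const t x)
  exact (hc (t, x)).hasFDerivAt.comp_hasDerivAt t h1

lemma hasFDeriv_slice_x {F : Type*} [NormedAddCommGroup F] [NormedSpace ℝ F]
    {G : ℝ × E2 → F} (hc : Differentiable ℝ G) (t : ℝ) (x : E2) :
    HasFDerivAt (fun y => G (t, y))
      ((fderiv ℝ G (t, x)).comp (ContinuousLinearMap.inr ℝ ℝ E2)) x := by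
  exact (hc (t, x)).hasFDerivAt.comp x (hasFDerivAt_prodMk_right t x)

lemma hasDeriv_integral {K : Set E2} (hK : IsCompact K) {G : ℝ × E2 → ℝ} (hc : ContDiff ℝ 1 G)
    (hG : ∀ t x, x ∉ K → G (t, x) = 0) (t : ℝ) :
    HasDerivAt (fun s => ∫ x, G (s, x)) (∫ x, fderiv ℝ G (t, x) (1, 0)) t := by
  have hcont : Continuous (fun p => fderiv ℝ G p (1, 0)) :=
    (hc.continuous_fderiv (by simp)).clm_apply continuous_const
  obtain ⟨C, hC⟩ := ((isCompact_closedBall t 1).prod hK).exists_bound_of_continuousOn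
    hcont.continuousOn
  have hdz : ∀ s x, x ∉ K → fderiv ℝ G (s, x) (1, 0) = 0 := fun s x hx => by
    rw [fd_zero_off hK hG s x hx]; simp
  refine (hasDerivAt_integral_of_dominated_loc_of_deriv_le (μ := volume)
    (F := fun s x => G (s, x)) (F' := fun s x => fderiv ℝ G (s, x) (1, 0))
    (bound := K.indicator fun _ => C) (Metric.ball_mem_nhds t one_pos) ?_ ?_ ?_ ?_ ?_ ?_).2
  · exact Filter.Eventually.of_forall fun s =>
      (slice_integrable hK hc.continuous hG s).aestronglyMeasurable
  · exact slice_integrable hK hc.continuous hG t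
  · exact (slice_integrable hK hcont hdz t).aestronglyMeasurable
  · refine Filter.Eventually.of_forall fun x s hs => ?_
    by_cases hx : x ∈ K
    · rw [Set.indicator_of_mem hx]
      exact hC (s, x) ⟨Metric.ball_subset_closedBall hs, hx⟩
    · rw [Set.indicator_of_notMem hx, hdz s x hx]; simp
  · exact (integrable_indicator_iff hK.measurableSet).2
      (integrableOn_const hK.measure_lt_top.ne)
  · exact Filter.Eventually.of_forall fun x s _ =>
      hasDeriv_slice_t (hc.differentiable (by simp)) s x

/-- Spatial integration by parts on a time slice. -/
lemma slice_ibp {K : Set E2} (hK : IsCompact K) {G H : ℝ × E2 → ℝ} (hc : ContDiff ℝ 1 G)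
    (hd : ContDiff ℝ 1 H) (hG : ∀ t x, x ∉ K → G (t, x) = 0) (t : ℝ) (v : E2) :
    ∫ x, G (t, x) * fderiv ℝ H (t, x) (0, v) = - ∫ x, fderiv ℝ G (t, x) (0, v) * H (t, x) := by
  have hcont : Continuous (fun p => fderiv ℝ G p (0, v)) :=
    (hc.continuous_fderiv (by simp)).clm_apply continuous_const
  have hcont' : Continuous (fun p => fderiv ℝ H p (0, v)) :=
    (hd.continuous_fderiv (by simp)).clm_apply continuous_const
  have hdz : ∀ s x, x ∉ K → fderiv ℝ G (s, x) (0, v) = 0 := fun s x hx => by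
    rw [fd_zero_off hK hG s x hx]; simp
  have eG : ∀ x, fderiv ℝ (fun y => G (t, y)) x v = fderiv ℝ G (t, x) (0, v) := fun x => by
    rw [(hasFDeriv_slice_x (hc.differentiable (by simp)) t x).fderiv]; simp
  have eH : ∀ x, fderiv ℝ (fun y => H (t, y)) x v = fderiv ℝ H (t, x) (0, v) := fun x => by
    rw [(hasFDeriv_slice_x (hd.differentiable (by simp)) t x).fderiv]; simp
  have := integral_mul_fderiv_eq_neg_fderiv_mul_of_integrable (μ := (volume : Measure E2))
    (f := fun y => G (t, y)) (g := fun y => H (t, y)) (v := v)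
    (by simp only [eG]
        exact slice_integrable hK (G := fun p => fderiv ℝ G p (0, v) * H p)
          (hcont.mul hd.continuous) (fun s x hx => by rw [hdz s x hx, zero_mul]) t)
    (by simp only [eH]
        exact slice_integrable hK (G := fun p => G p * fderiv ℝ H p (0, v))
          (hc.continuous.mul hcont') (fun s x hx => by rw [hG s x hx, zero_mul]) t)
    (slice_integrable hK (G := fun p => G p * H p)
          (hc.continuous.mul hd.continuous)
          (fun s x hx => by rw [hG s x hx, zero_mul]) t)
    (fun x _ => (hasFDeriv_slice_x (hc.differentiable (by simp)) t x).differentiableAt)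
    (fun x _ => (hasFDeriv_slice_x (hd.differentiable (by simp)) t x).differentiableAt)
  simpa only [eG, eH] using this

lemma main_aux
    (k M : ℝ) (hk : 0 < k) (hM : 0 ≤ M)
    (Θ : ℝ × E2 → ℝ) (hΘ : ContDiff ℝ 2 Θ)
    (K : Set E2) (hK : IsCompact K)
    (hsupp : ∀ t, Function.support (fun x => Θ (t, x)) ⊆ K)
    (U : ℝ × E2 → E2)
    (hUbdd : ∀ t x, ‖U (t, x)‖ ≤ M)
    (Υ : ℝ × E2 → ℝ)
    (hΥ2 : ∀ t, MemLp (fun x => Υ (t, x)) 2 volume)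
    (hpde : ∀ t x, dts Θ t x - k * slapS Θ t x + ⟪U (t, x), sgrad Θ t x⟫ = Υ (t, x)) :
    Differentiable ℝ (fun t => ∫ x, ‖sgrad Θ t x‖ ^ 2) ∧
      ∀ t, (1 / 2) * (∫ x, dts Θ t x ^ 2) +
          (k / 2) * deriv (fun s => ∫ x, ‖sgrad Θ s x‖ ^ 2) t ≤
        (∫ x, Υ (t, x) ^ 2) + M ^ 2 * ∫ x, ‖sgrad Θ t x‖ ^ 2 := by
  have hz : ∀ t x, x ∉ K → Θ (t, x) = 0 := fun t x hx => by
    by_contra h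
    exact hx (hsupp t h)
  have hΘd : Differentiable ℝ Θ := hΘ.differentiable (by simp)
  have hD : ContDiff ℝ 1 (fderiv ℝ Θ) := hΘ.fderiv_right (by norm_num)
  have hDd : Differentiable ℝ (fderiv ℝ Θ) := hD.differentiable (by simp)
  let e : Fin 2 → E2 := fun i => EuclideanSpace.single i 1
  let g : Fin 2 → ℝ × E2 → ℝ := fun i p => fderiv ℝ Θ p (0, e i)
  let h : ℝ × E2 → ℝ := fun p => fderiv ℝ Θ p (1, 0)
  have hg : ∀ i, ContDiff ℝ 1 (g i) := fun i => hD.clm_apply contDiff_const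
  have hh : ContDiff ℝ 1 h := hD.clm_apply contDiff_const
  have hgz : ∀ i t x, x ∉ K → g i (t, x) = 0 := fun i t x hx => by
    simp only [g]; rw [fd_zero_off hK hz t x hx]; simp
  have hhz : ∀ t x, x ∉ K → h (t, x) = 0 := fun t x hx => by
    simp only [h]; rw [fd_zero_off hK hz t x hx]; simp
  have fapp : ∀ (v w : ℝ × E2) p,
      fderiv ℝ (fun p => fderiv ℝ Θ p v) p w = fderiv ℝ (fderiv ℝ Θ) p w v := fun v w p => by
    rw [fderiv_clm_apply (hDd p) (differentiableAt_const v)]; simp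
  have hdts : ∀ t x, dts Θ t x = h (t, x) := fun t x => (hasDeriv_slice_t hΘd t x).deriv
  have hsl : ∀ t x, slapS Θ t x = ∑ i, fderiv ℝ (g i) (t, x) (0, e i) := fun t x => by
    have h1 : (fderiv ℝ fun y => Θ (t, y)) =
        fun y => (fderiv ℝ Θ (t, y)).comp (ContinuousLinearMap.inr ℝ ℝ E2) := by
      ext1 y; exact (hasFDeriv_slice_x hΘd t y).fderiv
    have h2 := (hasFDeriv_slice_x hDd t x).clm_comp
      (hasFDerivAt_const (ContinuousLinearMap.inr ℝ ℝ E2) x)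
    unfold slapS
    rw [h1, h2.fderiv]
    refine Finset.sum_congr rfl fun i _ => ?_
    simp only [g, fapp]
    simp [e]
  have hgr : ∀ t x, ‖sgrad Θ t x‖ ^ 2 = ∑ i, g i (t, x) ^ 2 := fun t x => by
    rw [EuclideanSpace.real_norm_sq_eq]
    refine Finset.sum_congr rfl fun i _ => ?_
    congr 1
    have h3 : ⟪sgrad Θ t x, e i⟫ = g i (t, x) := by
      unfold sgrad gradient
      rw [InnerProductSpace.toDual_symm_apply, (hasFDeriv_slice_x hΘd t x).fderiv]
      simp [g]
    rw [← h3]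
    simp [e, EuclideanSpace.inner_single_right]
  have hsymm : ∀ i p, fderiv ℝ (g i) p (1, 0) = fderiv ℝ h p (0, e i) := fun i p => by
    simp only [g, h, fapp]
    exact (hΘ.contDiffAt.isSymmSndFDerivAt (by simp)).eq _ _
  have hF : ∀ t, HasDerivAt (fun s => ∫ x, ‖sgrad Θ s x‖ ^ 2)
      (-2 * ∫ x, slapS Θ t x * dts Θ t x) t := fun t => by
    have hGc : ContDiff ℝ 1 (fun p => ∑ i, g i p ^ 2) :=
      ContDiff.sum fun i _ => (hg i).pow 2
    have h4 := hasDeriv_integral hK hGc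
      (fun s x hx => Finset.sum_eq_zero fun i _ => by rw [hgz i s x hx]; simp) t
    simp only [hgr]
    convert h4 using 1
    have h5 : ∀ x, fderiv ℝ (fun p => ∑ i, g i p ^ 2) (t, x) (1, 0) =
        ∑ i, 2 * (g i (t, x) * fderiv ℝ h (t, x) (0, e i)) := fun x => by
      rw [fderiv_fun_sum (A := fun i p => g i p ^ 2)
        fun i _ => ((hg i).differentiable (by simp) _).pow 2]
      rw [ContinuousLinearMap.sum_apply]
      refine Finset.sum_congr rfl fun i _ => ?_
      rw [fderiv_fun_pow _ ((hg i).differentiable (by simp) _), ← hsymm]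
      simp; ring
    simp only [h5, hsl, hdts, Finset.sum_mul]
    have c1 : ∀ i, Continuous (fun p => fderiv ℝ (g i) p (0, e i)) := fun i =>
      ((hg i).continuous_fderiv (by simp)).clm_apply continuous_const
    have c2 : ∀ i, Continuous (fun p => fderiv ℝ h p (0, e i)) := fun i =>
      (hh.continuous_fderiv (by simp)).clm_apply continuous_const
    rw [integral_finsetSum, integral_finsetSum, Finset.mul_sum]
    · refine Finset.sum_congr rfl fun i _ => ?_
      rw [integral_const_mul, slice_ibp hK (hg i) hh (hgz i) t (e i)]
      ring
    · exact fun i _ => (slice_integrable hK (G := fun p => g i p * fderiv ℝ h p (0, e i))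
        ((hg i).continuous.mul (c2 i))
        (fun s x hx => by rw [hgz i s x hx, zero_mul]) t).const_mul 2
    · exact fun i _ => slice_integrable hK (G := fun p => fderiv ℝ (g i) p (0, e i) * h p)
        ((c1 i).mul hh.continuous)
        (fun s x hx => by rw [hhz s x hx, mul_zero]) t
  refine ⟨fun t => (hF t).differentiableAt, fun t => ?_⟩
  rw [(hF t).deriv]
  have i1 : Integrable (fun x => dts Θ t x ^ 2) := by
    simp only [hdts]
    exact slice_integrable hK (G := fun p => h p ^ 2) (hh.continuous.pow 2)
      (fun s x hx => by rw [hhz s x hx]; simp) t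
  have i2 : Integrable (fun x => slapS Θ t x * dts Θ t x) := by
    simp only [hdts, hsl]
    refine slice_integrable hK (G := fun p => (∑ i, fderiv ℝ (g i) p (0, e i)) * h p)
      (Continuous.mul (continuous_finsetSum _ fun i _ =>
        ((hg i).continuous_fderiv (by simp)).clm_apply continuous_const) hh.continuous)
      (fun s x hx => by rw [hhz s x hx]; simp) t
  have i3 : Integrable (fun x => ‖sgrad Θ t x‖ ^ 2) := by
    simp only [hgr]
    exact slice_integrable hK (G := fun p => ∑ i, g i p ^ 2)
      (continuous_finsetSum _ fun i _ => (hg i).continuous.pow 2)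
      (fun s x hx => Finset.sum_eq_zero fun i _ => by rw [hgz i s x hx]; simp) t
  have i4 : Integrable (fun x => Υ (t, x) ^ 2) := (hΥ2 t).integrable_sq
  have key : ∫ x, ((1 / 2) * dts Θ t x ^ 2 - k * (slapS Θ t x * dts Θ t x)) ≤
      ∫ x, (Υ (t, x) ^ 2 + M ^ 2 * ‖sgrad Θ t x‖ ^ 2) := by
    refine integral_mono ((i1.const_mul _).sub (i2.const_mul _)) (i4.add (i3.const_mul _))
      fun x => ?_
    have hp := hpde t x
    have hcs : ⟪U (t, x), sgrad Θ t x⟫ ^ 2 ≤ M ^ 2 * ‖sgrad Θ t x‖ ^ 2 := by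
      rw [← mul_pow, ← sq_abs]
      refine pow_le_pow_left₀ (abs_nonneg _) ((abs_real_inner_le_norm _ _).trans ?_) 2
      exact mul_le_mul_of_nonneg_right (hUbdd t x) (norm_nonneg _)
    simp only
    generalize dts Θ t x = a at *
    generalize slapS Θ t x = b at *
    generalize ⟪U (t, x), sgrad Θ t x⟫ = c at *
    generalize Υ (t, x) = y at *
    have h6 : k * (b * a) = (a + c - y) * a := by rw [← hp]; ring
    nlinarith [sq_nonneg (a - (y - c)), sq_nonneg (y + c)]
  rw [integral_sub (i1.const_mul _) (i2.const_mul _), integral_add i4 (i3.const_mul _),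
    integral_const_mul, integral_const_mul, integral_const_mul] at key
  linarith

/-- the a priori estimate (3.25)–(3.26) in the proof of Theorem 2:
for a solution `Θ` of `∂ₜΘ − k ΔΘ + U·∇Θ = Υ` with solenoidal transport field `U`
bounded by `M`, and compact spatial support, the function `F(t) = ∫ |∇Θ(t,·)|²` is
differentiable and satisfies
`(1/2) ∫ (∂ₜΘ(t,·))² + (k/2) F'(t) ≤ ∫ Υ(t,·)² + M² F(t)`. -/
theorem time_derivative_energy_estimate_heat_convection
    (k M : ℝ) (hk : 0 < k) (hM : 0 ≤ M)
    (Θ : ℝ × E2 → ℝ) (hΘ : ContDiff ℝ 2 Θ)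
    (K : Set E2) (hK : IsCompact K)
    (hsupp : ∀ t, Function.support (fun x => Θ (t, x)) ⊆ K)
    (U : ℝ × E2 → E2) (hU : Continuous U)
    (hdiv : ∀ t x, LinearMap.trace ℝ E2
      (fderiv ℝ (fun y => U (t, y)) x : E2 →ₗ[ℝ] E2) = 0)
    (hUbdd : ∀ t x, ‖U (t, x)‖ ≤ M)
    (Υ : ℝ × E2 → ℝ) (hΥ : Continuous Υ)
    (hΥ2 : ∀ t, MemLp (fun x => Υ (t, x)) 2 volume)
    (hpde : ∀ t x, dts Θ t x - k * slapS Θ t x + ⟪U (t, x), sgrad Θ t x⟫ = Υ (t, x)) :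
    Differentiable ℝ (fun t => ∫ x, ‖sgrad Θ t x‖ ^ 2) ∧
      ∀ t, (1 / 2) * (∫ x, dts Θ t x ^ 2) +
          (k / 2) * deriv (fun s => ∫ x, ‖sgrad Θ s x‖ ^ 2) t ≤
        (∫ x, Υ (t, x) ^ 2) + M ^ 2 * ∫ x, ‖sgrad Θ t x‖ ^ 2 := by
  exact main_aux k M hk hM Θ hΘ K hK hsupp U hUbdd Υ hΥ2 hpde
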